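/- arXiv:2406.10182 — 15 statements merged into one kernel-verified Lean document; each statement's English description precedes it below -/
import Mathlib

section
/- Let (X,R) be a relational frame. For every A ⊆ X, the following are equivalent: (a) A = ¬_R B for some B ⊆ X (i.e., A belongs to the positive algebra χ⁺_R(X)); (b) C_R(A) = A, i.e., for every x ∈ X: x ∈ A if and only if for every x' with x' R x there exists y with x' R y and y ∈ A. -/
def negR {X : Type*} (R : X → X → Prop) (A : Set X) : Set X := {x | ∀ x', R x' x → x' ∉ A}

def nnegR {X : Type*} (R : X → X → Prop) (A : Set X) : Set X := {x | ∀ x', R x x' → x' ∉ A}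

def CR {X : Type*} (R : X → X → Prop) (A : Set X) : Set X :=
  {x | ∀ y, R y x → ∃ z, R y z ∧ z ∈ A}

def posAlg {X : Type*} (R : X → X → Prop) : Set (Set X) := {A | CR R A = A}

def negAlg {X : Type*} (R : X → X → Prop) : Set (Set X) := {A | ∃ B, A = nnegR R B}

def plePos {X : Type*} (R : X → X → Prop) (x x' : X) : Prop := ∀ z, R z x → R z x'

def nleNeg {X : Type*} (R : X → X → Prop) (x x' : X) : Prop := ∀ z, R x z → R x' z

def CoSerial {X : Type*} (R : X → X → Prop) : Prop := ∀ x, ∃ x', R x' x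

def PseudoRefl {X : Type*} (R : X → X → Prop) : Prop := ∀ x, ∃ y, R y x ∧ plePos R y x

def PseudoSym {X : Type*} (R : X → X → Prop) : Prop :=
  ∀ x x', R x x' → ∃ y, R y x ∧ plePos R y x'

def IsFundFrame {X : Type*} (R : X → X → Prop) : Prop :=
  CoSerial R ∧ PseudoRefl R ∧ PseudoSym R

theorem CR_eq_negR_nnegR {X : Type*} (R : X → X → Prop) (A : Set X) :
    CR R A = negR R (nnegR R A) := by
  ext x
  simp [CR, negR, nnegR]

theorem CR_negR {X : Type*} (R : X → X → Prop) (B : Set X) :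
    CR R (negR R B) = negR R B := by
  ext x
  constructor
  · intro hx y hyx
    obtain ⟨z, hyz, hz⟩ := hx y hyx
    exact hz y hyz
  · intro hx y hyx
    exact ⟨x, hyx, hx⟩

theorem stmt0 {X : Type*} (R : X → X → Prop) (hR : CoSerial R) (A : Set X) :
    (∃ B : Set X, A = negR R B) ↔ CR R A = A := by
  constructor
  · rintro ⟨B, rfl⟩
    exact CR_negR R B
  · intro h
    exact ⟨nnegR R A, h.symm.trans (CR_eq_negR_nnegR R A)⟩
end

section
/- Let (X,R) be a relational frame. For every x ∈ X, the sets {y ∈ X | y ≤⁺_R x} and {y ∈ X | ¬(x R y)} are fixpoints of C_R, i.e., they belong to the positive algebra χ⁺_R(X). -/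
theorem subset_CR {X : Type*} (R : X → X → Prop) (A : Set X) : A ⊆ CR R A :=
  fun x hx _ hy => ⟨x, hy, hx⟩

theorem mem_posAlg_of_CR_subset {X : Type*} {R : X → X → Prop} {A : Set X} (h : CR R A ⊆ A) :
    A ∈ posAlg R :=
  h.antisymm (subset_CR R A)

theorem stmt1 {X : Type*} (R : X → X → Prop) (hR : CoSerial R) (x : X) :
    {y | plePos R y x} ∈ posAlg R ∧ {y | ¬ R x y} ∈ posAlg R := by
  constructor
  · refine mem_posAlg_of_CR_subset fun w hw y hy => ?_
    obtain ⟨z, hyz, hz⟩ := hw y hy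
    exact hz y hyz
  · refine mem_posAlg_of_CR_subset fun w hw hxw => ?_
    obtain ⟨z, hxz, hz⟩ := hw x hxw
    exact hz hxz
end

section
/- Let (X,R) be a relational frame. For all x, x' ∈ X: x ≤⁺_R x' if and only if for every A ∈ χ⁺_R(X), x' ∈ A implies x ∈ A. -/
theorem negR_mem_posAlg {X : Type*} (R : X → X → Prop) (A : Set X) : negR R A ∈ posAlg R := by
  refine Set.Subset.antisymm (fun x hx y hyx hy => ?_) (subset_CR R _)
  obtain ⟨z, hyz, hz⟩ := hx y hyx
  exact hz y hyz hy

theorem stmt2 {X : Type*} (R : X → X → Prop) (hR : CoSerial R) (x x' : X) :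
    plePos R x x' ↔ ∀ A ∈ posAlg R, x' ∈ A → x ∈ A := by
  constructor
  · intro h A hA hx'
    rw [← show CR R A = A from hA] at hx' ⊢
    exact fun y hy => hx' y (h y hy)
  · intro h z hz
    by_contra hzx'
    refine h _ (negR_mem_posAlg R {z}) ?_ z hz rfl
    rintro _ hy rfl
    exact hzx' hy
end

section
/- Let h : (X,R) → (Y,S) be an f-morphism between fundamental frames. Then for every A ∈ χ⁺_S(Y), h⁻¹[¬_S A] = ¬_R h⁻¹[A]. -/
def IsFMorphism {X Y : Type*} (R : X → X → Prop) (S : Y → Y → Prop) (h : X → Y) : Prop :=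
  (∀ x x', R x x' → S (h x) (h x')) ∧
  (∀ x y, S (h x) y → ∃ x', R x x' ∧ plePos S (h x') y) ∧
  (∀ x y, S y (h x) → ∃ x', R x' x ∧ nleNeg S (h x') y) ∧
  (∀ x y, S y (h x) → ∃ x'', R x'' x ∧ plePos S (h x'') y)

theorem mem_of_plePos {Y : Type*} {S : Y → Y → Prop} {A : Set Y} (hA : A ∈ posAlg S)
    {y y' : Y} (hy : plePos S y y') (hy' : y' ∈ A) : y ∈ A := by
  change CR S A = A at hA
  rw [← hA] at hy' ⊢
  exact fun z hz => hy' z (hy z hz)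

theorem stmt4 {X Y : Type*} (R : X → X → Prop) (S : Y → Y → Prop)
    (hR : IsFundFrame R) (hS : IsFundFrame S)
    (h : X → Y) (hh : IsFMorphism R S h) :
    ∀ A ∈ posAlg S, h ⁻¹' (negR S A) = negR R (h ⁻¹' A) := by
  obtain ⟨hmono, -, -, hlift⟩ := hh
  intro A hA
  ext x
  constructor
  · exact fun hx x' hx' => hx (h x') (hmono x' x hx')
  · intro hx y hy hyA
    obtain ⟨x', hx', hle⟩ := hlift x y hy
    exact hx x' hx' (mem_of_plePos hA hle hyA)
end

section
/- Let f : (L,¬) → (M,∼) be a fundamental lattice homomorphism. For each point x = (x_F, x_I) of the canonical frame Ϝ(M), the pair (f⁻¹[x_F], f⁻¹[x_I]) is a point of the canonical frame Ϝ(L), and the map Ϝ(f) : x ↦ (f⁻¹[x_F], f⁻¹[x_I]) is an f-morphism from Ϝ(M) to Ϝ(L). Moreover, for every a ∈ L, Ϝ(f)⁻¹[â] = \widehat{f(a)} (the hat taken in Ϝ(M)). -/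
def IsProperFilter {L : Type*} [Lattice L] [BoundedOrder L] (F : Set L) : Prop :=
  ⊤ ∈ F ∧ ⊥ ∉ F ∧ (∀ a b, a ∈ F → a ≤ b → b ∈ F) ∧ (∀ a b, a ∈ F → b ∈ F → a ⊓ b ∈ F)

def IsProperIdeal {L : Type*} [Lattice L] [BoundedOrder L] (I : Set L) : Prop :=
  ⊥ ∈ I ∧ ⊤ ∉ I ∧ (∀ a b, a ∈ I → b ≤ a → b ∈ I) ∧ (∀ a b, a ∈ I → b ∈ I → a ⊔ b ∈ I)

def IsFundLattice {L : Type*} [Lattice L] [BoundedOrder L] (neg : L → L) : Prop :=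
  (∀ a b, a ≤ neg b ↔ b ≤ neg a) ∧ (∀ a, a ⊓ neg a = ⊥)

structure CanPoint (L : Type*) [Lattice L] [BoundedOrder L] (neg : L → L) where
  F : Set L
  I : Set L
  hF : IsProperFilter F
  hI : IsProperIdeal I
  compat : ∀ a ∈ F, neg a ∈ I

def canRel {L : Type*} [Lattice L] [BoundedOrder L] {neg : L → L}
    (x y : CanPoint L neg) : Prop := x.I ∩ y.F = ∅

def hat {L : Type*} [Lattice L] [BoundedOrder L] (neg : L → L) (a : L) :
    Set (CanPoint L neg) := {x | a ∈ x.F}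

def IsFundHom {L M : Type*} [Lattice L] [BoundedOrder L] [Lattice M] [BoundedOrder M]
    (negL : L → L) (negM : M → M) (f : L → M) : Prop :=
  f ⊤ = ⊤ ∧ f ⊥ = ⊥ ∧ (∀ a b, f (a ⊓ b) = f a ⊓ f b) ∧
  (∀ a b, f (a ⊔ b) = f a ⊔ f b) ∧ (∀ a, f (negL a) = negM (f a))

section

variable {L M : Type*} [Lattice L] [BoundedOrder L] [Lattice M] [BoundedOrder M]
  {negL : L → L} {negM : M → M} {f : L → M}

theorem IsFundLattice.neg_antitone (hL : IsFundLattice negL) : Antitone negL := fun a b h =>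
  (hL.1 a (negL b)).1 (h.trans ((hL.1 (negL b) b).1 le_rfl))

theorem IsFundLattice.neg_bot (hL : IsFundLattice negL) : negL ⊥ = ⊤ :=
  top_unique ((hL.1 ⊤ ⊥).2 bot_le)

theorem IsFundLattice.neg_top (hL : IsFundLattice negL) : negL ⊤ = ⊥ := by
  simpa using hL.2 ⊤

theorem IsFundLattice.eq_bot_of_neg_eq_top (hL : IsFundLattice negL) {a : L}
    (h : negL a = ⊤) : a = ⊥ := by
  simpa [h] using hL.2 a

theorem IsFundHom.monotone (hf : IsFundHom negL negM f) : Monotone f := fun a b h => by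
  rw [← inf_eq_left, ← hf.2.2.1, inf_eq_left.2 h]

theorem canRel_iff {x y : CanPoint L negL} : canRel x y ↔ ∀ a ∈ x.I, a ∉ y.F := by
  simp [canRel, Set.eq_empty_iff_forall_notMem]

theorem plePos_canRel_of_subset {x y : CanPoint L negL} (h : y.F ⊆ x.F) :
    plePos canRel x y := fun _ hz =>
  canRel_iff.2 fun a ha hy => canRel_iff.1 hz a ha (h hy)

theorem nleNeg_canRel_of_subset {x y : CanPoint L negL} (h : y.I ⊆ x.I) :
    nleNeg canRel x y := fun _ hz =>
  canRel_iff.2 fun a ha => canRel_iff.1 hz a (h ha)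

/-- The preimage of a point of the canonical frame under a homomorphism. -/
def CanPoint.comap (hf : IsFundHom negL negM f) (x : CanPoint M negM) : CanPoint L negL where
  F := f ⁻¹' x.F
  I := f ⁻¹' x.I
  hF := by
    obtain ⟨htop, hbot, hup, hinf⟩ := x.hF
    refine ⟨by simpa [hf.1], by simpa [hf.2.1], fun a b ha hab => hup _ _ ha (hf.monotone hab),
      fun a b ha hb => ?_⟩
    simpa [hf.2.2.1] using hinf _ _ ha hb
  hI := by
    obtain ⟨hbot, htop, hdown, hsup⟩ := x.hI
    refine ⟨by simpa [hf.2.1], by simpa [hf.1], fun a b ha hab => hdown _ _ ha (hf.monotone hab),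
      fun a b ha hb => ?_⟩
    simpa [hf.2.2.2.1] using hsup _ _ ha hb
  compat a ha := by simpa [hf.2.2.2.2] using x.compat _ ha

/-- The point whose filter is generated by the image of the filter of `y`, and whose ideal is
generated by the negations of the elements of that image. -/
def CanPoint.mapFilter (hM : IsFundLattice negM) (hf : IsFundHom negL negM f)
    (y : CanPoint L negL) (hy : ∀ a ∈ y.F, f a ≠ ⊥) : CanPoint M negM where
  F := {b | ∃ a ∈ y.F, f a ≤ b}
  I := {b | ∃ a ∈ y.F, b ≤ negM (f a)}
  hF := by
    refine ⟨⟨⊤, y.hF.1, le_top⟩, fun ⟨a, ha, h⟩ => hy a ha (le_bot_iff.1 h),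
      fun b c ⟨a, ha, h⟩ hbc => ⟨a, ha, h.trans hbc⟩, ?_⟩
    rintro b c ⟨a, ha, hab⟩ ⟨d, hd, hdc⟩
    exact ⟨a ⊓ d, y.hF.2.2.2 _ _ ha hd, hf.2.2.1 a d ▸ inf_le_inf hab hdc⟩
  hI := by
    refine ⟨⟨⊤, y.hF.1, bot_le⟩,
      fun ⟨a, ha, h⟩ => hy a ha (hM.eq_bot_of_neg_eq_top (top_unique h)),
      fun b c ⟨a, ha, h⟩ hcb => ⟨a, ha, hcb.trans h⟩, ?_⟩
    rintro b c ⟨a, ha, hab⟩ ⟨d, hd, hdc⟩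
    exact ⟨a ⊓ d, y.hF.2.2.2 _ _ ha hd,
      sup_le (hab.trans (hM.neg_antitone (hf.monotone inf_le_left)))
        (hdc.trans (hM.neg_antitone (hf.monotone inf_le_right)))⟩
  compat _ := fun ⟨a, ha, h⟩ => ⟨a, ha, hM.neg_antitone h⟩

/-- The point with trivial filter whose ideal is generated by the image of the ideal of `y`. -/
def CanPoint.mapIdeal (hM : IsFundLattice negM) (hf : IsFundHom negL negM f)
    (y : CanPoint L negL) (hy : ∀ a ∈ y.I, f a ≠ ⊤) : CanPoint M negM where
  F := {⊤}
  I := {b | ∃ a ∈ y.I, b ≤ f a}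
  hF := by
    refine ⟨rfl, fun h => hy ⊥ y.hI.1 (hf.2.1.trans h), ?_, ?_⟩
    · rintro a b rfl h
      exact top_unique h
    · rintro a b rfl rfl
      exact inf_idem _
  hI := by
    refine ⟨⟨⊥, y.hI.1, bot_le⟩, fun ⟨a, ha, h⟩ => hy a ha (top_unique h),
      fun b c ⟨a, ha, h⟩ hcb => ⟨a, ha, hcb.trans h⟩, ?_⟩
    rintro b c ⟨a, ha, hab⟩ ⟨d, hd, hdc⟩
    exact ⟨a ⊔ d, y.hI.2.2.2 _ _ ha hd, hf.2.2.2.1 a d ▸ sup_le_sup hab hdc⟩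
  compat := by
    rintro a rfl
    exact ⟨⊥, y.hI.1, hM.neg_top.trans_le bot_le⟩

theorem CanPoint.isFMorphism_comap (hM : IsFundLattice negM) (hf : IsFundHom negL negM f) :
    IsFMorphism canRel canRel (CanPoint.comap hf) := by
  refine ⟨fun x x' h => canRel_iff.2 fun a => canRel_iff.1 h (f a), fun x y h => ?_,
    fun x y h => ?_, fun x y h => ?_⟩ <;> rw [canRel_iff] at h
  · refine ⟨y.mapFilter hM hf fun a ha h0 => h a ?_ ha, canRel_iff.2 ?_,
      plePos_canRel_of_subset fun a ha => ⟨a, ha, le_rfl⟩⟩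
    · change f a ∈ x.I
      exact h0 ▸ x.hI.1
    · rintro b hb ⟨a, ha, hab⟩
      exact h a (x.hI.2.2.1 _ _ hb hab) ha
  · refine ⟨y.mapIdeal hM hf fun a ha h1 => h a ha ?_, canRel_iff.2 ?_,
      nleNeg_canRel_of_subset fun a ha => ⟨a, ha, le_rfl⟩⟩
    · change f a ∈ x.F
      exact h1 ▸ x.hF.1
    · rintro b ⟨a, ha, hba⟩ hb
      exact h a ha (x.hF.2.2.1 _ _ hb hba)
  · have hneg : ∀ a ∈ y.F, negM (f a) ∉ x.F := fun a ha hx =>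
      h (negL a) (y.compat a ha) (by change f (negL a) ∈ x.F; rwa [hf.2.2.2.2])
    refine ⟨y.mapFilter hM hf fun a ha h0 => hneg a ha ?_, canRel_iff.2 ?_,
      plePos_canRel_of_subset fun a ha => ⟨a, ha, le_rfl⟩⟩
    · rw [h0, hM.neg_bot]
      exact x.hF.1
    · rintro b ⟨a, ha, hba⟩ hb
      exact hneg a ha (x.hF.2.2.1 _ _ hb hba)

end

theorem stmt5 {L M : Type*} [Lattice L] [BoundedOrder L] [Lattice M] [BoundedOrder M]
    (negL : L → L) (negM : M → M)
    (hL : IsFundLattice negL) (hM : IsFundLattice negM)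
    (f : L → M) (hf : IsFundHom negL negM f) :
    ∃ g : CanPoint M negM → CanPoint L negL,
      (∀ x : CanPoint M negM, (g x).F = f ⁻¹' x.F ∧ (g x).I = f ⁻¹' x.I) ∧
      IsFMorphism (@canRel M _ _ negM) (@canRel L _ _ negL) g ∧
      (∀ a : L, g ⁻¹' (hat negL a) = hat negM (f a)) := by
  exact ⟨CanPoint.comap hf, fun _ => ⟨rfl, rfl⟩, CanPoint.isFMorphism_comap hM hf, fun _ => rfl⟩
end

section
/- Let h : (X,R) → (Y,S) be an f-morphism between fundamental frames. The map χ(h) : χ⁺_S(Y) → χ⁺_R(X) given by A ↦ h⁻¹[A] is surjective if and only if h is an embedding. -/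
theorem CR_mem_posAlg {X : Type*} (R : X → X → Prop) (A : Set X) : CR R A ∈ posAlg R := by
  refine Set.Subset.antisymm (fun x hx y hy => ?_) (subset_CR R _)
  obtain ⟨z, hyz, hz⟩ := hx y hy
  exact hz y hyz

theorem mem_of_plePos_of_mem_posAlg {X : Type*} {R : X → X → Prop} {A : Set X}
    (hA : A ∈ posAlg R) {x x' : X} (hle : plePos R x x') (hx' : x' ∈ A) : x ∈ A := by
  have hA : CR R A = A := hA
  rw [← hA]
  exact fun y hy => ⟨x', hle y hy, hx'⟩

theorem setOf_plePos_mem_posAlg {X : Type*} (R : X → X → Prop) (a : X) :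
    {x | plePos R x a} ∈ posAlg R := by
  refine Set.Subset.antisymm (fun x hx y hy => ?_) (subset_CR R _)
  obtain ⟨z, hyz, hz⟩ := hx y hy
  exact hz y hyz

theorem stmt8 {X Y : Type*} (R : X → X → Prop) (S : Y → Y → Prop)
    (hR : IsFundFrame R) (hS : IsFundFrame S)
    (h : X → Y) (hh : IsFMorphism R S h) :
    (∀ A ∈ posAlg R, ∃ B ∈ posAlg S, h ⁻¹' B = A) ↔
    (∀ x x' : X, S (h x) (h x') → ∃ z, R x z ∧ plePos R z x') := by
  constructor
  · intro hsurj x x' hxx'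
    obtain ⟨B, hB, hBA⟩ := hsurj _ (setOf_plePos_mem_posAlg R x')
    have hx' : x' ∈ h ⁻¹' B := by
      rw [hBA]
      exact fun _ hz => hz
    obtain ⟨z, hxz, hz⟩ := hh.2.1 x (h x') hxx'
    have hzB : z ∈ h ⁻¹' B := mem_of_plePos_of_mem_posAlg hB hz hx'
    rw [hBA] at hzB
    exact ⟨z, hxz, hzB⟩
  · intro hemb A hA
    refine ⟨CR S (h '' A), CR_mem_posAlg S _, Set.Subset.antisymm (fun x hx => ?_)
      (fun x hx => subset_CR S _ ⟨x, hx, rfl⟩)⟩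
    have hA' : CR R A = A := hA
    rw [← hA']
    intro y hy
    obtain ⟨_, hya, a, ha, rfl⟩ := hx (h y) (hh.1 y x hy)
    obtain ⟨z, hyz, hz⟩ := hemb y a hya
    exact ⟨z, hyz, mem_of_plePos_of_mem_posAlg hA hz ha⟩
end

section
/- Let h : (X,R) → (Y,S) be an f-morphism between fundamental frames that is an embedding. Then for every A ∈ χ⁺_R(X), A = h⁻¹[h[A]]. -/
theorem stmt9 {X Y : Type*} (R : X → X → Prop) (S : Y → Y → Prop)
    (hR : IsFundFrame R) (hS : IsFundFrame S)
    (h : X → Y) (hh : IsFMorphism R S h)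
    (hemb : ∀ x x' : X, S (h x) (h x') → ∃ z, R x z ∧ plePos R z x') :
    ∀ A ∈ posAlg R, A = h ⁻¹' (h '' A) := by
  intro A hA
  have mem_iff (x : X) : x ∈ A ↔ ∀ y, R y x → ∃ z, R y z ∧ z ∈ A :=
    (Set.ext_iff.mp hA x).symm
  refine (Set.subset_preimage_image h A).antisymm ?_
  rintro x ⟨a, ha, hax⟩
  refine (mem_iff x).mpr fun y hyx => ?_
  obtain ⟨z, hyz, hza⟩ := hemb y a (hax ▸ hh.1 y x hyx)
  exact ⟨z, hyz, (mem_iff z).mpr fun w hwz => (mem_iff a).mp ha w (hza w hwz)⟩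
end

section
/- Let f : (L,¬) → (M,∼) be a fundamental lattice homomorphism and let Ϝ(f) : Ϝ(M) → Ϝ(L) be the map (x_F, x_I) ↦ (f⁻¹[x_F], f⁻¹[x_I]) between canonical frames, with R the canonical relation on Ϝ(M) and S the canonical relation on Ϝ(L). Then f is surjective if and only if Ϝ(f) is a strong embedding, i.e., for all points x, x' of Ϝ(M), Ϝ(f)(x) S Ϝ(f)(x') implies x R x'. -/
theorem IsFundLattice.antitone {L : Type*} [Lattice L] [BoundedOrder L] {neg : L → L}
    (h : IsFundLattice neg) : Antitone neg := fun _ b hab =>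
  (h.1 _ _).2 (hab.trans ((h.1 b (neg b)).2 le_rfl))

theorem IsFundLattice.neg_top_s11 {L : Type*} [Lattice L] [BoundedOrder L] {neg : L → L}
    (h : IsFundLattice neg) : neg ⊤ = ⊥ := by
  simpa using h.2 ⊤

theorem IsFundLattice.eq_bot_of_neg_eq_top_s11 {L : Type*} [Lattice L] [BoundedOrder L] {neg : L → L}
    (h : IsFundLattice neg) {a : L} (ha : neg a = ⊤) : a = ⊥ := by
  simpa [ha] using h.2 a

theorem isProperFilter_Ici {L : Type*} [Lattice L] [BoundedOrder L] {a : L} (ha : a ≠ ⊥) :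
    IsProperFilter (Set.Ici a) :=
  ⟨le_top, fun h => ha (le_bot_iff.1 h), fun _ _ h => le_trans h, fun _ _ => le_inf⟩

theorem isProperIdeal_Iic {L : Type*} [Lattice L] [BoundedOrder L] {a : L} (ha : a ≠ ⊤) :
    IsProperIdeal (Set.Iic a) :=
  ⟨bot_le, fun h => ha (top_le_iff.1 h), fun _ _ h h' => le_trans h' h, fun _ _ => sup_le⟩

/-- The canonical point given by a principal filter and a principal ideal. -/
def CanPoint.principal {L : Type*} [Lattice L] [BoundedOrder L] {neg : L → L}
    (h : IsFundLattice neg) (a b : L) (ha : a ≠ ⊥) (hb : b ≠ ⊤) (hab : neg a ≤ b) :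
    CanPoint L neg where
  F := Set.Ici a
  I := Set.Iic b
  hF := isProperFilter_Ici ha
  hI := isProperIdeal_Iic hb
  compat _ hc := (h.antitone hc).trans hab

theorem stmt11 {L M : Type*} [Lattice L] [BoundedOrder L] [Lattice M] [BoundedOrder M]
    (negL : L → L) (negM : M → M)
    (hL : IsFundLattice negL) (hM : IsFundLattice negM)
    (f : L → M) (hf : IsFundHom negL negM f)
    (g : CanPoint M negM → CanPoint L negL)
    (hg : ∀ x : CanPoint M negM, (g x).F = f ⁻¹' x.F ∧ (g x).I = f ⁻¹' x.I) :
    Function.Surjective f ↔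
      ∀ x x' : CanPoint M negM, canRel (g x) (g x') → canRel x x' := by
  constructor
  · intro hs x x' h
    refine Set.eq_empty_of_forall_notMem fun b hb => ?_
    obtain ⟨a, rfl⟩ := hs b
    have ha : a ∈ (g x).I ∩ (g x').F := by
      rw [(hg x).2, (hg x').1]
      exact hb
    exact Set.notMem_empty a (h ▸ ha)
  · intro h b
    by_cases hb : b = ⊥
    · exact ⟨⊥, hf.2.1.trans hb.symm⟩
    by_cases hb' : b = ⊤
    · exact ⟨⊤, hf.1.trans hb'.symm⟩
    have hbt : (⊤ : M) ≠ ⊥ := fun e => hb (le_bot_iff.1 (e ▸ le_top))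
    let x : CanPoint M negM := .principal hM ⊤ b hbt hb' (hM.neg_top_s11 ▸ bot_le)
    let x' : CanPoint M negM :=
      .principal hM b (negM b) hb (fun e => hb (hM.eq_bot_of_neg_eq_top_s11 e)) le_rfl
    have hx : ¬ canRel x x' := fun e =>
      Set.notMem_empty b (e ▸ (⟨le_refl b, le_refl b⟩ : b ∈ x.I ∩ x'.F))
    obtain ⟨a, haI, haF⟩ := Set.nonempty_iff_ne_empty.2 (mt (h x x') hx)
    rw [(hg x).2] at haI
    rw [(hg x').1] at haF
    exact ⟨a, le_antisymm haI haF⟩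
end

section
/- Let {(X_i, R_i)}_{i∈I} be a family of fundamental frames and let (X_I, R_I) be their coproduct: X_I is the disjoint union Σ_{i∈I} X_i, and (i,x) R_I (j,y) iff i = j and x R_i y. Then the map sending a family (A_i)_{i∈I} with each A_i ∈ χ⁺_{R_i}(X_i) to the set {(i,x) ∈ X_I | x ∈ A_i} is an order isomorphism from the product lattice ∏_{i∈I} χ⁺_{R_i}(X_i) (ordered componentwise by inclusion) onto χ⁺_{R_I}(X_I) (ordered by inclusion). -/
def coprodRel {ι : Type*} {X : ι → Type*} (R : ∀ i, X i → X i → Prop)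
    (p q : Σ i, X i) : Prop :=
  ∃ h : p.1 = q.1, R q.1 (h ▸ p.2) q.2

@[simp]
theorem coprodRel_mk_mk {ι : Type*} {X : ι → Type*} (R : ∀ i, X i → X i → Prop)
    {i : ι} (x y : X i) : coprodRel R ⟨i, x⟩ ⟨i, y⟩ ↔ R i x y :=
  ⟨fun ⟨_, h⟩ => h, fun h => ⟨rfl, h⟩⟩

/-- The closure operator of a coproduct is computed in each summand separately. -/
theorem mk_mem_CR_coprodRel {ι : Type*} {X : ι → Type*} (R : ∀ i, X i → X i → Prop)
    (B : Set (Σ i, X i)) (i : ι) (x : X i) :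
    ⟨i, x⟩ ∈ CR (coprodRel R) B ↔ x ∈ CR (R i) (Sigma.mk i ⁻¹' B) := by
  constructor
  · intro h y hy
    obtain ⟨⟨j, z⟩, hyz, hz⟩ := h ⟨i, y⟩ ((coprodRel_mk_mk R y x).2 hy)
    obtain rfl : i = j := hyz.1
    exact ⟨z, (coprodRel_mk_mk R y z).1 hyz, hz⟩
  · rintro h ⟨j, y⟩ hy
    obtain rfl : j = i := hy.1
    obtain ⟨z, hyz, hz⟩ := h y ((coprodRel_mk_mk R y x).1 hy)
    exact ⟨⟨j, z⟩, (coprodRel_mk_mk R y z).2 hyz, hz⟩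

theorem mem_posAlg_coprodRel {ι : Type*} {X : ι → Type*} (R : ∀ i, X i → X i → Prop)
    (B : Set (Σ i, X i)) :
    B ∈ posAlg (coprodRel R) ↔ ∀ i, Sigma.mk i ⁻¹' B ∈ posAlg (R i) := by
  constructor
  · intro h i
    ext x
    rw [← mk_mem_CR_coprodRel, show CR (coprodRel R) B = B from h, Set.mem_preimage]
  · intro h
    ext ⟨i, x⟩
    rw [mk_mem_CR_coprodRel, show CR (R i) (Sigma.mk i ⁻¹' B) = Sigma.mk i ⁻¹' B from h i,
      Set.mem_preimage]

theorem stmt12 {ι : Type*} {X : ι → Type*} (R : ∀ i, X i → X i → Prop)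
    (hR : ∀ i, IsFundFrame (R i)) :
    ∃ e : (∀ i, {A : Set (X i) // A ∈ posAlg (R i)}) ≃o
          {A : Set (Σ i, X i) // A ∈ posAlg (coprodRel R)},
      ∀ f : ∀ i, {A : Set (X i) // A ∈ posAlg (R i)},
        (e f : Set (Σ i, X i)) = {p : Σ i, X i | p.2 ∈ (f p.1 : Set (X p.1))} := by
  refine ⟨{
    toFun := fun f => ⟨{p | p.2 ∈ (f p.1 : Set (X p.1))},
      (mem_posAlg_coprodRel R _).2 fun i => (f i).2⟩
    invFun := fun B i => ⟨Sigma.mk i ⁻¹' B.1, (mem_posAlg_coprodRel R B.1).1 B.2 i⟩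
    left_inv := fun _ => rfl
    right_inv := fun _ => rfl
    map_rel_iff' := ⟨fun h i x hx => @h ⟨i, x⟩ hx, fun h p hp => h p.1 hp⟩ }, fun _ => rfl⟩
end

section
/- Let (L,¬) be a fundamental lattice and let (X,R) = Ϝ(L) be its canonical frame. Then every A ∈ χ⁺_R(X) satisfies A = ⋃_{x∈A} ⋂_{a∈x_F} â. -/
theorem stmt13 {L : Type*} [Lattice L] [BoundedOrder L] (neg : L → L)
    (hL : IsFundLattice neg)
    (A : Set (CanPoint L neg)) (hA : A ∈ posAlg (@canRel L _ _ neg)) :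
    A = ⋃ x ∈ A, ⋂ a ∈ CanPoint.F x, hat neg a := by
  ext y
  simp only [Set.mem_iUnion, Set.mem_iInter, exists_prop]
  constructor
  · exact fun hy => ⟨y, hy, fun _ ha => ha⟩
  · rintro ⟨x, hx, hxy⟩
    have hx' : x ∈ CR canRel A := hA.symm ▸ hx
    have hy : y ∈ CR canRel A := fun z hz =>
      hx' z (Set.subset_eq_empty (Set.inter_subset_inter_right z.I hxy) hz)
    exact hA ▸ hy
end

section
/- Let (L,¬) be a fundamental lattice and let (X,R) = Ϝ(L) be its canonical frame. For all subsets A, B ⊆ L: if ⋂_{a∈A} â ⊆ C_R(⋃_{b∈B} b̂), then there exist finite subsets A' ⊆ A and B' ⊆ B such that the meet of A' is ≤ the join of B' in L (where the meet of the empty set is ⊤ and the join of the empty set is ⊥). -/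
namespace IsFundLattice

variable {L : Type*} [Lattice L] [BoundedOrder L] {neg : L → L}

theorem neg_top_s14 (hL : IsFundLattice neg) : neg ⊤ = ⊥ := by
  simpa using hL.2 ⊤

theorem neg_antitone_s14 (hL : IsFundLattice neg) : Antitone neg := fun a b hab =>
  (hL.1 a (neg b)).1 (hab.trans ((hL.1 b (neg b)).2 le_rfl))

theorem eq_bot_of_top_le_neg (hL : IsFundLattice neg) {a : L} (ha : ⊤ ≤ neg a) : a = ⊥ :=
  le_bot_iff.1 (((hL.1 ⊤ a).1 ha).trans hL.neg_top_s14.le)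

/-- A proper filter, paired with the ideal generated by the negations of its elements. -/
def pointOfFilter (hL : IsFundLattice neg) {F : Set L} (hF : IsProperFilter F) :
    CanPoint L neg where
  F := F
  I := {c | ∃ a ∈ F, c ≤ neg a}
  hF := hF
  hI := by
    refine ⟨⟨⊤, hF.1, bot_le⟩, ?_, ?_, ?_⟩
    · rintro ⟨a, ha, hle⟩
      exact hF.2.1 (hL.eq_bot_of_top_le_neg hle ▸ ha)
    · rintro a b ⟨c, hc, hac⟩ hba
      exact ⟨c, hc, hba.trans hac⟩
    · rintro a b ⟨c, hc, hac⟩ ⟨d, hd, hbd⟩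
      exact ⟨c ⊓ d, hF.2.2.2 c d hc hd, sup_le (hac.trans (hL.neg_antitone_s14 inf_le_left))
        (hbd.trans (hL.neg_antitone_s14 inf_le_right))⟩
  compat a ha := ⟨a, ha, le_rfl⟩

/-- A proper ideal, paired with the trivial filter. -/
def pointOfIdeal (hL : IsFundLattice neg) {I : Set L} (hI : IsProperIdeal I) :
    CanPoint L neg where
  F := {⊤}
  I := I
  hF := by
    refine ⟨rfl, fun h => hI.2.1 ?_, ?_, ?_⟩
    · rw [← Set.mem_singleton_iff.1 h]
      exact hI.1
    · rintro a b rfl hab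
      exact top_le_iff.1 hab
    · rintro a b rfl rfl
      exact inf_idem ⊤
  hI := hI
  compat := by
    rintro a rfl
    rw [hL.neg_top_s14]
    exact hI.1

end IsFundLattice

theorem stmt14 {L : Type*} [Lattice L] [BoundedOrder L] (neg : L → L)
    (hL : IsFundLattice neg) (A B : Set L)
    (h : (⋂ a ∈ A, hat neg a) ⊆ CR (@canRel L _ _ neg) (⋃ b ∈ B, hat neg b)) :
    ∃ (A' B' : Finset L), ↑A' ⊆ A ∧ ↑B' ⊆ B ∧ A'.inf id ≤ B'.sup id := by
  classical
  by_contra hcon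
  push Not at hcon
  have hF : IsProperFilter {c | ∃ A' : Finset L, ↑A' ⊆ A ∧ A'.inf id ≤ c} := by
    refine ⟨⟨∅, by simp, le_top⟩, ?_, ?_, ?_⟩
    · rintro ⟨A', hA', hle⟩
      exact hcon A' ∅ hA' (by simp) (hle.trans bot_le)
    · rintro a b ⟨A', hA', hle⟩ hab
      exact ⟨A', hA', hle.trans hab⟩
    · rintro a b ⟨A₁, hA₁, h₁⟩ ⟨A₂, hA₂, h₂⟩
      refine ⟨A₁ ∪ A₂, by simp [hA₁, hA₂], ?_⟩
      rw [Finset.inf_union]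
      exact inf_le_inf h₁ h₂
  have hI : IsProperIdeal {c | ∃ B' : Finset L, ↑B' ⊆ B ∧ c ≤ B'.sup id} := by
    refine ⟨⟨∅, by simp, bot_le⟩, ?_, ?_, ?_⟩
    · rintro ⟨B', hB', hle⟩
      exact hcon ∅ B' (by simp) hB' (le_top.trans hle)
    · rintro a b ⟨B', hB', hle⟩ hba
      exact ⟨B', hB', hba.trans hle⟩
    · rintro a b ⟨B₁, hB₁, h₁⟩ ⟨B₂, hB₂, h₂⟩
      refine ⟨B₁ ∪ B₂, by simp [hB₁, hB₂], ?_⟩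
      rw [Finset.sup_union]
      exact sup_le_sup h₁ h₂
  have hx : hL.pointOfFilter hF ∈ ⋂ a ∈ A, hat neg a :=
    Set.mem_iInter₂.2 fun a ha => ⟨{a}, by simpa using ha, by simp⟩
  have hyx : canRel (hL.pointOfIdeal hI) (hL.pointOfFilter hF) := by
    refine Set.eq_empty_iff_forall_notMem.2 ?_
    rintro c ⟨⟨B', hB', hc⟩, A', hA', hc'⟩
    exact hcon A' B' hA' hB' (hc'.trans hc)
  obtain ⟨z, hyz, hz⟩ := h hx _ hyx
  obtain ⟨b, hb, hbz⟩ := Set.mem_iUnion₂.1 hz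
  exact Set.eq_empty_iff_forall_notMem.1 hyz b ⟨⟨{b}, by simpa using hb, by simp⟩, hbz⟩
end

section
/- Let (L,¬) be a fundamental lattice and let (X,R) = Ϝ(L) be its canonical frame. Then for every A ∈ χ⁺_R(X): ¬_R A = ⋂_{x∈A} C_R(⋃_{a∈x_F} \widehat{¬a}). -/
/-- Membership in a fixpoint of `CR` depends only on the filter component of a point. -/
theorem mem_of_F_eq {L : Type*} [Lattice L] [BoundedOrder L] {neg : L → L}
    {A : Set (CanPoint L neg)} (hA : A ∈ posAlg (@canRel L _ _ neg))
    {x x' : CanPoint L neg} (h : x'.F = x.F) (hx : x ∈ A) : x' ∈ A := by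
  have hA' : CR (@canRel L _ _ neg) A = A := hA
  rw [← hA'] at hx ⊢
  intro y hy
  exact hx y (by rwa [canRel, h] at hy)

/-- The point given by the principal filter of `b` and the principal ideal of `neg b`. -/
def principalPoint {L : Type*} [Lattice L] [BoundedOrder L] {neg : L → L}
    (hL : IsFundLattice neg) (b : L) (hb : b ≠ ⊥) : CanPoint L neg where
  F := Set.Ici b
  I := Set.Iic (neg b)
  hF := ⟨le_top, fun h => hb (le_bot_iff.mp h), fun _ _ h h' => le_trans h h',
    fun _ _ h h' => le_inf h h'⟩
  hI := ⟨bot_le, fun h => hb <| by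
      have h_top : neg b = ⊤ := top_le_iff.mp h
      simpa [h_top] using hL.2 b,
    fun _ _ h h' => le_trans h' h, fun _ _ h h' => sup_le h h'⟩
  compat := fun c hc =>
    (hL.1 _ _).mp (le_trans hc ((hL.1 _ _).mp le_rfl))

/-- An element outside the ideal of `w` lies in the filter of some `canRel`-successor of `w`. -/
theorem exists_canRel_mem_hat {L : Type*} [Lattice L] [BoundedOrder L] {neg : L → L}
    (hL : IsFundLattice neg) {w : CanPoint L neg} {b : L} (hb : b ∉ w.I) :
    ∃ z, canRel w z ∧ z ∈ hat neg b := by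
  refine ⟨principalPoint hL b fun h => hb (h ▸ w.hI.1), ?_, le_refl b⟩
  refine Set.eq_empty_of_forall_notMem ?_
  rintro c ⟨hcI, hcF⟩
  exact hb (w.hI.2.2.1 c b hcI hcF)

theorem stmt15 {L : Type*} [Lattice L] [BoundedOrder L] (neg : L → L)
    (hL : IsFundLattice neg)
    (A : Set (CanPoint L neg)) (hA : A ∈ posAlg (@canRel L _ _ neg)) :
    negR (@canRel L _ _ neg) A =
      ⋂ x ∈ A, CR (@canRel L _ _ neg) (⋃ a ∈ CanPoint.F x, hat neg (neg a)) := by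
  ext y
  simp only [Set.mem_iInter]
  constructor
  · intro hy x hx w hw
    by_cases h : ∀ a ∈ x.F, neg a ∈ w.I
    · let v : CanPoint L neg := ⟨x.F, w.I, x.hF, w.hI, h⟩
      exact absurd (mem_of_F_eq hA (x := x) (x' := v) rfl hx) (hy v hw)
    · push Not at h
      obtain ⟨a, ha, haw⟩ := h
      obtain ⟨z, hwz, hz⟩ := exists_canRel_mem_hat hL haw
      exact ⟨z, hwz, Set.mem_biUnion ha hz⟩
  · intro hy x hxy hx
    obtain ⟨z, hxz, hz⟩ := hy x hx x hxy
    obtain ⟨a, ha, haz⟩ := Set.mem_iUnion₂.mp hz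
    exact Set.notMem_empty (neg a) (hxz ▸ ⟨x.compat a ha, haz⟩)
end

section
/- Let (X,R) and (Y,S) be fundamental frames, and let M and N be binary relations on X and Y respectively such that □_N B ∈ χ⁻_S(Y) for every B ∈ χ⁻_S(Y). Let h : X → Y be an f-morphism satisfying: (i) x M x' implies h(x) N h(x'), and (ii) if h(x) N y then there is x' ∈ X with x M x', y ≤⁺_S h(x') and y ≤⁻_S h(x'). Then h⁻¹[□_N A] = □_M h⁻¹[A] for every A ∈ χ⁺_S(Y) ∪ χ⁻_S(Y), and h⁻¹[◇_N A] = ◇_M h⁻¹[A] for every A ∈ χ⁺_S(Y). -/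
def boxOp {X : Type*} (M : X → X → Prop) (A : Set X) : Set X := {x | ∀ y, M x y → y ∈ A}

def diaOp {X : Type*} (R M : X → X → Prop) (A : Set X) : Set X :=
  negR R (boxOp M (nnegR R A))

theorem mem_of_plePos_s16 {X : Type*} {R : X → X → Prop} {A : Set X} (hA : A ∈ posAlg R)
    {x x' : X} (hx : plePos R x x') (hx' : x' ∈ A) : x ∈ A := by
  have hA : CR R A = A := hA
  rw [← hA] at hx' ⊢
  exact fun z hz => hx' z (hx z hz)

theorem mem_of_nleNeg {X : Type*} {R : X → X → Prop} {A : Set X} (hA : A ∈ negAlg R)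
    {x x' : X} (hx : nleNeg R x x') (hx' : x' ∈ A) : x ∈ A := by
  obtain ⟨B, rfl⟩ := hA
  exact fun z hz => hx' z (hx z hz)

theorem preimage_nnegR {X Y : Type*} {R : X → X → Prop} {S : Y → Y → Prop} {h : X → Y}
    (hh : IsFMorphism R S h) {A : Set Y} (hA : A ∈ posAlg S) :
    h ⁻¹' (nnegR S A) = nnegR R (h ⁻¹' A) := by
  ext x
  refine ⟨fun hx x' hxx' => hx _ (hh.1 _ _ hxx'), fun hx y hy hyA => ?_⟩
  obtain ⟨x', hxx', hle⟩ := hh.2.1 x y hy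
  exact hx x' hxx' (mem_of_plePos_s16 hA hle hyA)

theorem preimage_negR {X Y : Type*} {R : X → X → Prop} {S : Y → Y → Prop} {h : X → Y}
    (hh : IsFMorphism R S h) {B : Set Y} (hB : B ∈ negAlg S) :
    h ⁻¹' (negR S B) = negR R (h ⁻¹' B) := by
  ext x
  refine ⟨fun hx x' hxx' => hx _ (hh.1 _ _ hxx'), fun hx y hy hyB => ?_⟩
  obtain ⟨x', hxx', hle⟩ := hh.2.2.1 x y hy
  exact hx x' hxx' (mem_of_nleNeg hB hle hyB)

theorem stmt16 {X Y : Type*} (R : X → X → Prop) (S : Y → Y → Prop)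
    (M : X → X → Prop) (N : Y → Y → Prop)
    (hR : IsFundFrame R) (hS : IsFundFrame S)
    (hN : ∀ B ∈ negAlg S, boxOp N B ∈ negAlg S)
    (h : X → Y) (hh : IsFMorphism R S h)
    (h1 : ∀ x x', M x x' → N (h x) (h x'))
    (h2 : ∀ (x : X) (y : Y), N (h x) y →
      ∃ x', M x x' ∧ plePos S y (h x') ∧ nleNeg S y (h x')) :
    (∀ A ∈ posAlg S ∪ negAlg S, h ⁻¹' (boxOp N A) = boxOp M (h ⁻¹' A)) ∧
    (∀ A ∈ posAlg S, h ⁻¹' (diaOp S N A) = diaOp R M (h ⁻¹' A)) := by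
  have hbox : ∀ A ∈ posAlg S ∪ negAlg S, h ⁻¹' (boxOp N A) = boxOp M (h ⁻¹' A) := by
    intro A hA
    ext x
    refine ⟨fun hx x' hxx' => hx _ (h1 _ _ hxx'), fun hx y hy => ?_⟩
    obtain ⟨x', hxx', hpos, hneg⟩ := h2 x y hy
    exact hA.elim (fun hA => mem_of_plePos_s16 hA hpos (hx x' hxx'))
      (fun hA => mem_of_nleNeg hA hneg (hx x' hxx'))
  refine ⟨hbox, fun A hA => ?_⟩
  have hneg : nnegR S A ∈ negAlg S := ⟨A, rfl⟩
  rw [diaOp, diaOp, preimage_negR hh (hN _ hneg), hbox _ (Or.inr hneg), preimage_nnegR hh hA]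
end

section
/- Let (L, ¬, □_L, ◇_L) and (N, ∼, □_N, ◇_N) be fundamental modal lattices and f : L → N a fundamental modal lattice homomorphism. Let Ϝ(f) : Ϝ(N) → Ϝ(L) be the map (x_F, x_I) ↦ (f⁻¹[x_F], f⁻¹[x_I]) between canonical frames, and let M_L, M_N be the canonical modal relations on Ϝ(L), Ϝ(N) respectively. Then: (i) for all points x, y of Ϝ(N), x M_N y implies Ϝ(f)(x) M_L Ϝ(f)(y); and (ii) for every point x of Ϝ(N) and every point y of Ϝ(L) with Ϝ(f)(x) M_L y, there exists a point x' of Ϝ(N) such that x M_N x', (Ϝ(f)(x'))_F ⊆ y_F and (Ϝ(f)(x'))_I ⊆ y_I. -/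
def IsFundModalLattice {L : Type*} [Lattice L] [BoundedOrder L]
    (neg box dia : L → L) : Prop :=
  IsFundLattice neg ∧ (∀ a b, box (a ⊓ b) = box a ⊓ box b) ∧ box ⊤ = ⊤ ∧
  (∀ a b, dia (a ⊔ b) = dia a ⊔ dia b) ∧ dia ⊥ = ⊥ ∧ (∀ a, dia (neg a) ≤ neg (box a))

def modRel {L : Type*} [Lattice L] [BoundedOrder L] {neg : L → L} (box dia : L → L)
    (x y : CanPoint L neg) : Prop :=
  (∀ a, box a ∈ x.F → a ∈ y.F) ∧ (∀ b, dia b ∈ x.I → b ∈ y.I)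

/-- The point whose filter and ideal are the preimages of those of `x` under `box` and `dia`. -/
def CanPoint.modSucc {L : Type*} [Lattice L] [BoundedOrder L] {neg box dia : L → L}
    (h : IsFundModalLattice neg box dia) (x : CanPoint L neg)
    (hbot : box ⊥ ∉ x.F) (htop : dia ⊤ ∉ x.I) : CanPoint L neg where
  F := box ⁻¹' x.F
  I := dia ⁻¹' x.I
  hF := by
    obtain ⟨-, hinf, hbox_top, -⟩ := h
    obtain ⟨hx_top, -, hx_up, hx_inf⟩ := x.hF
    refine ⟨by simpa [hbox_top] using hx_top, hbot, fun a b ha hab => ?_, fun a b ha hb => ?_⟩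
    · refine hx_up _ _ ha (inf_eq_left.1 ?_)
      rw [← hinf, inf_eq_left.2 hab]
    · simpa [hinf] using hx_inf _ _ ha hb
  hI := by
    obtain ⟨-, -, -, hsup, hdia_bot, -⟩ := h
    obtain ⟨hx_bot, -, hx_down, hx_sup⟩ := x.hI
    refine ⟨by simpa [hdia_bot] using hx_bot, htop, fun a b ha hba => ?_, fun a b ha hb => ?_⟩
    · refine hx_down _ _ ha (sup_eq_right.1 ?_)
      rw [← hsup, sup_eq_right.2 hba]
    · simpa [hsup] using hx_sup _ _ ha hb
  compat a ha := x.hI.2.2.1 _ _ (x.compat _ ha) (h.2.2.2.2.2 a)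

theorem stmt17 {L N : Type*} [Lattice L] [BoundedOrder L] [Lattice N] [BoundedOrder N]
    (negL boxL diaL : L → L) (negN boxN diaN : N → N)
    (hL : IsFundModalLattice negL boxL diaL) (hN : IsFundModalLattice negN boxN diaN)
    (f : L → N) (hf : IsFundHom negL negN f)
    (hbox : ∀ a, f (boxL a) = boxN (f a)) (hdia : ∀ a, f (diaL a) = diaN (f a))
    (g : CanPoint N negN → CanPoint L negL)
    (hg : ∀ x : CanPoint N negN, (g x).F = f ⁻¹' x.F ∧ (g x).I = f ⁻¹' x.I) :
    (∀ x y : CanPoint N negN, modRel boxN diaN x y → modRel boxL diaL (g x) (g y)) ∧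
    (∀ (x : CanPoint N negN) (y : CanPoint L negL), modRel boxL diaL (g x) y →
      ∃ x' : CanPoint N negN, modRel boxN diaN x x' ∧ (g x').F ⊆ y.F ∧ (g x').I ⊆ y.I) := by
  obtain ⟨hf_top, hf_bot, -⟩ := hf
  have mem_F (x : CanPoint N negN) (a : L) : a ∈ (g x).F ↔ f a ∈ x.F := by
    rw [(hg x).1, Set.mem_preimage]
  have mem_I (x : CanPoint N negN) (a : L) : a ∈ (g x).I ↔ f a ∈ x.I := by
    rw [(hg x).2, Set.mem_preimage]
  refine ⟨fun x y hxy => ⟨fun a ha => ?_, fun b hb => ?_⟩, fun x y hxy => ?_⟩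
  · rw [mem_F, hbox] at ha
    exact (mem_F y a).2 (hxy.1 _ ha)
  · rw [mem_I, hdia] at hb
    exact (mem_I y b).2 (hxy.2 _ hb)
  · have box_mem (a : L) (ha : boxN (f a) ∈ x.F) : a ∈ y.F :=
      hxy.1 a ((mem_F x _).2 (by rwa [hbox]))
    have dia_mem (b : L) (hb : diaN (f b) ∈ x.I) : b ∈ y.I :=
      hxy.2 b ((mem_I x _).2 (by rwa [hdia]))
    refine ⟨x.modSucc hN (fun h => y.hF.2.1 (box_mem ⊥ (by rwa [hf_bot])))
      (fun h => y.hI.2.1 (dia_mem ⊤ (by rwa [hf_top]))),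
      ⟨fun _ ha => ha, fun _ hb => hb⟩, fun a ha => ?_, fun b hb => ?_⟩
    · exact box_mem a ((mem_F _ a).1 ha)
    · exact dia_mem b ((mem_I _ b).1 hb)
end

section
/- Let (L,¬) be a fundamental lattice with ⊥ ≠ ⊤, let (X,R) = Ϝ(L) be its canonical frame, let I be a proper ideal of L, and let A ⊆ X. Then A ⊆ C_R(⋃_{a∈I} â) if and only if x_F ∩ I ≠ ∅ for every x ∈ A. -/
theorem stmt18 {L : Type*} [Lattice L] [BoundedOrder L] (neg : L → L)
    (hL : IsFundLattice neg) (hbt : (⊥ : L) ≠ ⊤)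
    (I : Set L) (hI : IsProperIdeal I) (A : Set (CanPoint L neg)) :
    A ⊆ CR (@canRel L _ _ neg) (⋃ a ∈ I, hat neg a) ↔
      ∀ x ∈ A, (CanPoint.F x ∩ I).Nonempty := by
  constructor
  · intro h x hx
    by_contra hne
    rw [Set.not_nonempty_iff_eq_empty, Set.inter_comm] at hne
    let y : CanPoint L neg :=
      { F := {⊤}
        I := I
        hF := ⟨rfl, hbt, fun _ _ ha hab => top_le_iff.mp (ha ▸ hab),
          fun _ _ ha hb => by simp_all⟩
        hI := hI
        compat := by
          rintro _ rfl
          have hneg : neg (⊤ : L) = ⊥ := by simpa using hL.2 ⊤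
          exact hneg ▸ hI.1 }
    obtain ⟨z, hyz, hz⟩ := h hx y hne
    obtain ⟨a, haI, haz⟩ := Set.mem_iUnion₂.mp hz
    exact Set.notMem_empty a (hyz ▸ ⟨haI, haz⟩)
  · intro h x hx y hyx
    obtain ⟨a, haF, haI⟩ := h x hx
    exact ⟨x, hyx, Set.mem_iUnion₂.mpr ⟨a, haI, haF⟩⟩
end
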